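/- arXiv:0710.3640 — 2 statements merged into one kernel-verified Lean document; each statement's English description precedes it below -/
import Mathlib

section
/- Let (X_t)_{t=0,…,T} be an ℝ^d-valued Markov process, let f_t : ℝ^d → ℝ (t = 0, …, T) be bounded measurable payoff functions, and let the continuation values q_t be defined by the backward recursion q_T = 0 and, for t = T−1, …, 0, q_t is a bounded measurable function with q_t(X_t) = E[ max(f_{t+1}(X_{t+1}), q_{t+1}(X_{t+1})) | X_t ] almost surely. Then for every t ∈ {0, …, T−1} and every w ∈ {0, 1, …, T−t−1}, almost surely q_t(X_t) = E[ ϑ_{t+1:w}(f, q_{t+1}, …, q_{t+w+1})(X_{t+1}, …, X_{t+w+1}) | 𝔽_t ], where 𝔽_t = σ(X_0, …, X_t). -/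
open MeasureTheory ProbabilityTheory Finset

/-- The look-ahead payoff `ϑ_{t:w}(f,h)(x_t, …, x_{t+w})` of Egloff–Kohler–Todorovic. -/
noncomputable def vartheta {E : Type*} (f h : ℕ → E → ℝ) (t w : ℕ) (x : ℕ → E) : ℝ :=
  (∑ s ∈ Finset.Icc t (t + w),
      f s (x s) * (if 0 ≤ f s (x s) - h s (x s) then (1 : ℝ) else 0) *
        ∏ r ∈ Finset.Ico t s, (if f r (x r) - h r (x r) < 0 then (1 : ℝ) else 0)) +
    h (t + w) (x (t + w)) *
      ∏ r ∈ Finset.Icc t (t + w), (if f r (x r) - h r (x r) < 0 then (1 : ℝ) else 0)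

/-- The conditional expectation is self-adjoint. -/
theorem integral_condExp_mul_eq_integral_mul_condExp {Ω : Type*} {m mΩ : MeasurableSpace Ω}
    {μ : Measure Ω} [IsFiniteMeasure μ] (hm : m ≤ mΩ) {a b : Ω → ℝ} {C : ℝ}
    (ha : Integrable a μ) (haC : ∀ ω, |a ω| ≤ C) (hb : Integrable b μ) :
    ∫ ω, (μ[a|m] * b) ω ∂μ = ∫ ω, (a * μ[b|m]) ω ∂μ := by
  have hbdd : ∀ᵐ ω ∂μ, ‖(μ[a|m]) ω‖ ≤ C := ae_bdd_abs_condExp_of_ae_bdd_abs (ae_of_all _ haC)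
  have hl : Integrable (μ[a|m] * b) μ :=
    hb.bdd_mul integrable_condExp.aestronglyMeasurable hbdd
  have hr : Integrable (a * μ[b|m]) μ :=
    integrable_condExp.bdd_mul ha.aestronglyMeasurable (ae_of_all _ haC)
  rw [← integral_condExp hm (f := μ[a|m] * b), ← integral_condExp hm (f := a * μ[b|m])]
  exact integral_congr_ae
    ((condExp_mul_of_stronglyMeasurable_left stronglyMeasurable_condExp hl hb).trans
      (condExp_mul_of_stronglyMeasurable_right stronglyMeasurable_condExp hr ha).symm)

/-- If `m₁` and `m₂` are conditionally independent given `m ≤ m₁`, then conditioning an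
`m₂`-measurable function on `m₁` is the same as conditioning it on `m`. -/
theorem ProbabilityTheory.CondIndep.condExp_ae_eq_of_le {Ω : Type*} {m m₁ m₂ mΩ : MeasurableSpace Ω}
    [StandardBorelSpace Ω] {μ : Measure Ω} [IsFiniteMeasure μ] {hm : m ≤ mΩ}
    (h : CondIndep m m₁ m₂ hm μ) (hmm₁ : m ≤ m₁) (hm₁ : m₁ ≤ mΩ) (hm₂ : m₂ ≤ mΩ)
    {g : Ω → ℝ} (hgm : StronglyMeasurable[m₂] g) (hg : Integrable g μ) :
    μ[g|m] =ᵐ[μ] μ[g|m₁] := by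
  refine ae_eq_condExp_of_forall_setIntegral_eq hm₁ hg
    (fun _ _ _ => integrable_condExp.integrableOn) (fun s hs _ => ?_)
    (stronglyMeasurable_condExp.mono hmm₁).aestronglyMeasurable
  have hone : ∀ (B : Set Ω) (ω : Ω), |B.indicator (fun _ => (1 : ℝ)) ω| ≤ 1 := by
    intro B ω
    by_cases hω : ω ∈ B <;> simp [hω]
  have hint : ∀ B, MeasurableSet B → Integrable (B.indicator fun _ => (1 : ℝ)) μ :=
    fun B hB => (integrable_const 1).indicator hB
  have hmul : ∀ (B : Set Ω) (u : Ω → ℝ), (B.indicator fun _ => (1 : ℝ)) * u = B.indicator u := by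
    intro B u
    ext ω
    by_cases hω : ω ∈ B <;> simp [hω]
  have hs' : MeasurableSet s := hm₁ s hs
  set a : Ω → ℝ := s.indicator fun _ => (1 : ℝ) with ha
  have ha_cond : μ[a|m₂] =ᵐ[μ] μ[μ[a|m]|m₂] := by
    refine ae_eq_condExp_of_forall_setIntegral_eq hm₂ integrable_condExp
      (fun _ _ _ => integrable_condExp.integrableOn) (fun B hB _ => ?_)
      stronglyMeasurable_condExp.aestronglyMeasurable
    have hB' : MeasurableSet B := hm₂ B hB
    set b : Ω → ℝ := B.indicator fun _ => (1 : ℝ) with hb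
    have hprod := (condIndep_iff m m₁ m₂ hm hm₁ hm₂ μ).1 h s B hs hB
    have hmulint : Integrable (b * μ[a|m]) μ :=
      integrable_condExp.bdd_mul (hint B hB').aestronglyMeasurable (ae_of_all _ (hone B))
    rw [setIntegral_condExp hm₂ (hint s hs') hB]
    symm
    calc ∫ ω in B, (μ[a|m]) ω ∂μ
        = ∫ ω, (b * μ[a|m]) ω ∂μ := by rw [hmul, integral_indicator hB']
      _ = ∫ ω, (μ[b * μ[a|m]|m]) ω ∂μ := (integral_condExp hm).symm
      _ = ∫ ω, (μ[(s ∩ B).indicator fun _ => (1 : ℝ)|m]) ω ∂μ := by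
          refine integral_congr_ae ?_
          refine (condExp_mul_of_stronglyMeasurable_right stronglyMeasurable_condExp hmulint
            (hint B hB')).trans ?_
          rw [mul_comm]
          exact hprod.symm
      _ = ∫ ω, (s ∩ B).indicator (fun _ => (1 : ℝ)) ω ∂μ := integral_condExp hm
      _ = ∫ ω in B, a ω ∂μ := by
          rw [← integral_indicator hB', ha, Set.indicator_indicator, Set.inter_comm]
  have hag : Integrable (a * g) μ :=
    hg.bdd_mul (hint s hs').aestronglyMeasurable (ae_of_all _ (hone s))
  have hcg : Integrable (μ[a|m] * g) μ :=
    hg.bdd_mul integrable_condExp.aestronglyMeasurable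
      (ae_bdd_abs_condExp_of_ae_bdd_abs (ae_of_all _ (hone s)))
  calc ∫ ω in s, (μ[g|m]) ω ∂μ
      = ∫ ω, (a * μ[g|m]) ω ∂μ := by rw [hmul, integral_indicator hs']
    _ = ∫ ω, (μ[a|m] * g) ω ∂μ :=
        (integral_condExp_mul_eq_integral_mul_condExp hm (hint s hs') (hone s) hg).symm
    _ = ∫ ω, (μ[μ[a|m] * g|m₂]) ω ∂μ := (integral_condExp hm₂).symm
    _ = ∫ ω, (μ[a * g|m₂]) ω ∂μ := by
        refine integral_congr_ae ?_
        refine (condExp_mul_of_stronglyMeasurable_right hgm hcg integrable_condExp).trans ?_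
        refine (ha_cond.symm.mul (Filter.EventuallyEq.refl _ g)).trans ?_
        exact (condExp_mul_of_stronglyMeasurable_right hgm hag (hint s hs')).symm
    _ = ∫ ω, (a * g) ω ∂μ := integral_condExp hm₂
    _ = ∫ ω in s, g ω ∂μ := by rw [hmul, integral_indicator hs']

theorem vartheta_zero {E : Type*} (f h : ℕ → E → ℝ) (t : ℕ) (x : ℕ → E) :
    vartheta f h t 0 x = max (f t (x t)) (h t (x t)) := by
  rcases le_or_gt (h t (x t)) (f t (x t)) with hle | hlt
  · simp [vartheta, hle, hle.not_gt]
  · simp [vartheta, hlt, hlt.le, hlt.not_ge]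

theorem vartheta_succ {E : Type*} (f h : ℕ → E → ℝ) (t w : ℕ) (x : ℕ → E) :
    vartheta f h t (w + 1) x = vartheta f h t w x +
      (∏ r ∈ Finset.Icc t (t + w), (if f r (x r) - h r (x r) < 0 then (1 : ℝ) else 0)) *
        (max (f (t + w + 1) (x (t + w + 1))) (h (t + w + 1) (x (t + w + 1))) -
          h (t + w) (x (t + w))) := by
  have hIco : Finset.Ico t (t + w + 1) = Finset.Icc t (t + w) := by
    ext r
    simp only [Finset.mem_Ico, Finset.mem_Icc]
    omega
  unfold vartheta
  rw [← add_assoc t w 1, Finset.sum_Icc_succ_top (by omega), Finset.prod_Icc_succ_top (by omega),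
    hIco]
  rcases le_or_gt (h (t + w + 1) (x (t + w + 1))) (f (t + w + 1) (x (t + w + 1))) with hle | hlt
  · rw [if_pos (sub_nonneg.2 hle), if_neg (sub_nonneg.2 hle).not_gt, max_eq_left hle]
    ring
  · rw [if_neg (sub_neg.2 hlt).not_ge, if_pos (sub_neg.2 hlt), max_eq_right hlt.le]
    ring

/-- **Look-ahead representation of the continuation values** (equation (2.13)).
For a Markov process `(X_t)_{t ≤ T}` with bounded measurable payoffs `f_t` and continuation
values `q_t` defined by the dynamic programming recursion `q_T = 0`,
`q_t(X_t) = E[max(f_{t+1}(X_{t+1}), q_{t+1}(X_{t+1})) | X_t]` a.s., one has, for every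
`t ∈ {0,…,T−1}` and `w ∈ {0,…,T−t−1}`,
`q_t(X_t) = E[ϑ_{t+1:w}(f, q)(X_{t+1},…,X_{t+w+1}) | 𝔽_t]` almost surely, where
`𝔽_t = σ(X_0, …, X_t)`. -/
theorem continuation_value_look_ahead_representation
    {Ω : Type*} [MeasurableSpace Ω] [StandardBorelSpace Ω]
    (Pr : Measure Ω) [IsProbabilityMeasure Pr]
    (d T : ℕ) (X : ℕ → Ω → (Fin d → ℝ)) (hX : ∀ t, Measurable (X t))
    (hMarkov : ∀ t, CondIndep (MeasurableSpace.comap (X t) inferInstance)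
        (⨆ s ∈ Set.Iic t, MeasurableSpace.comap (X s) inferInstance)
        (⨆ s ∈ Set.Icc (t + 1) T, MeasurableSpace.comap (X s) inferInstance)
        ((hX t).comap_le) Pr)
    (f q : ℕ → (Fin d → ℝ) → ℝ)
    (hf : ∀ s, Measurable (f s)) (hfb : ∀ s, ∃ C, ∀ y, |f s y| ≤ C)
    (hq : ∀ s, Measurable (q s)) (hqb : ∀ s, ∃ C, ∀ y, |q s y| ≤ C)
    (hqT : q T = 0)
    (hqrec : ∀ t, t < T →
      (fun ω => q t (X t ω)) =ᵐ[Pr]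
        Pr[fun ω => max (f (t + 1) (X (t + 1) ω)) (q (t + 1) (X (t + 1) ω)) |
            MeasurableSpace.comap (X t) inferInstance]) :
    ∀ t w, t + w + 1 ≤ T →
      (fun ω => q t (X t ω)) =ᵐ[Pr]
        Pr[fun ω => vartheta f q (t + 1) w (fun s => X s ω) |
            ⨆ s ∈ Set.Iic t, MeasurableSpace.comap (X s) inferInstance] := by
  set F : ℕ → MeasurableSpace Ω :=
    fun t => ⨆ s ∈ Set.Iic t, MeasurableSpace.comap (X s) inferInstance with hF
  have hFle : ∀ t, F t ≤ ‹MeasurableSpace Ω› := fun t => iSup₂_le fun s _ => (hX s).comap_le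
  have hXF : ∀ {s t}, s ≤ t → MeasurableSpace.comap (X s) inferInstance ≤ F t :=
    fun {s t} hst => le_iSup₂ (f := fun s (_ : s ∈ Set.Iic t) =>
      MeasurableSpace.comap (X s) inferInstance) s hst
  have hFmono : ∀ {s t}, s ≤ t → F s ≤ F t :=
    fun {s t} hst => iSup₂_le fun r hr => hXF (le_trans hr hst)
  have hXm : ∀ {s t}, s ≤ t → Measurable[F t] (X s) :=
    fun hst => measurable_iff_comap_le.2 (hXF hst)
  have hbi : ∀ (u : (Fin d → ℝ) → ℝ) s, Measurable u → (∃ C, ∀ y, |u y| ≤ C) →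
      Integrable (fun ω => u (X s ω)) Pr := by
    rintro u s hu ⟨C, hC⟩
    exact Integrable.of_bound (hu.comp (hX s)).aestronglyMeasurable C (ae_of_all _ fun ω => hC _)
  have hqi : ∀ s, Integrable (fun ω => q s (X s ω)) Pr := fun s => hbi _ s (hq s) (hqb s)
  have hMi : ∀ s, Integrable (fun ω => max (f s (X s ω)) (q s (X s ω))) Pr :=
    fun s => (hbi _ s (hf s) (hfb s)).sup (hqi s)
  have hstep : ∀ t, t < T → (fun ω => q t (X t ω)) =ᵐ[Pr]
      Pr[fun ω => max (f (t + 1) (X (t + 1) ω)) (q (t + 1) (X (t + 1) ω)) | F t] := by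
    intro t ht
    refine (hqrec t ht).trans ((hMarkov t).condExp_ae_eq_of_le (hXF le_rfl) (hFle t)
      (iSup₂_le fun s _ => (hX s).comap_le) ?_ (hMi (t + 1)))
    have hXt : Measurable[⨆ s ∈ Set.Icc (t + 1) T, MeasurableSpace.comap (X s) inferInstance]
        (X (t + 1)) :=
      measurable_iff_comap_le.2 (le_iSup₂ (f := fun s (_ : s ∈ Set.Icc (t + 1) T) =>
        MeasurableSpace.comap (X s) inferInstance) (t + 1) ⟨le_rfl, ht⟩)
    exact (((hf (t + 1)).max (hq (t + 1))).comp hXt).stronglyMeasurable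
  have hmain : ∀ t w, t + w + 1 ≤ T →
      Integrable (fun ω => vartheta f q (t + 1) w (fun s => X s ω)) Pr ∧
      (fun ω => q t (X t ω)) =ᵐ[Pr]
        Pr[fun ω => vartheta f q (t + 1) w (fun s => X s ω) | F t] := by
    intro t w
    induction w with
    | zero =>
      intro ht
      simp only [vartheta_zero]
      exact ⟨hMi (t + 1), hstep t ht⟩
    | succ w ih =>
      intro ht
      obtain ⟨hVi, hVq⟩ := ih (by omega)
      set P : Ω → ℝ := fun ω => ∏ r ∈ Finset.Icc (t + 1) (t + 1 + w),
        (if f r (X r ω) - q r (X r ω) < 0 then (1 : ℝ) else 0) with hP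
      set M : Ω → ℝ := fun ω => max (f (t + 1 + w + 1) (X (t + 1 + w + 1) ω))
        (q (t + 1 + w + 1) (X (t + 1 + w + 1) ω)) with hM
      set Q : Ω → ℝ := fun ω => q (t + 1 + w) (X (t + 1 + w) ω) with hQ
      have hPm : StronglyMeasurable[F (t + 1 + w)] P := by
        refine Measurable.stronglyMeasurable (Finset.measurable_fun_prod _ fun r hr => ?_)
        have hXr := hXm (Finset.mem_Icc.1 hr).2
        refine Measurable.ite ?_ measurable_const measurable_const
        exact (((hf r).sub (hq r)).comp hXr) measurableSet_Iio
      have hPb : ∀ ω, ‖P ω‖ ≤ 1 := by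
        intro ω
        rw [hP, norm_prod]
        refine Finset.prod_le_one (fun _ _ => norm_nonneg _) fun r _ => ?_
        split_ifs <;> simp
      have hD : Integrable (M - Q) Pr := (hMi _).sub (hqi _)
      have hPD : Integrable (P * (M - Q)) Pr :=
        hD.bdd_mul (hPm.mono (hFle _)).aestronglyMeasurable (ae_of_all _ hPb)
      have hsucc : (fun ω => vartheta f q (t + 1) (w + 1) (fun s => X s ω)) =
          (fun ω => vartheta f q (t + 1) w (fun s => X s ω)) + P * (M - Q) :=
        funext fun ω => vartheta_succ f q (t + 1) w _
      have hQm : StronglyMeasurable[F (t + 1 + w)] Q :=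
        ((hq _).comp (hXm le_rfl)).stronglyMeasurable
      have hD0 : Pr[M - Q | F (t + 1 + w)] =ᵐ[Pr] 0 := by
        refine (condExp_sub (hMi _) (hqi _) _).trans ?_
        rw [condExp_of_stronglyMeasurable (hFle _) hQm (hqi _)]
        filter_upwards [hstep (t + 1 + w) (by omega)] with ω hω
        exact sub_eq_zero.2 hω.symm
      have hPD0 : Pr[P * (M - Q) | F (t + 1 + w)] =ᵐ[Pr] 0 := by
        refine (condExp_mul_of_stronglyMeasurable_left hPm hPD hD).trans ?_
        filter_upwards [hD0] with ω hω
        simp [hω]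
      have hPD0' : Pr[P * (M - Q) | F t] =ᵐ[Pr] 0 := by
        refine (condExp_condExp_of_le (hFmono (by omega : t ≤ t + 1 + w)) (hFle _)).symm.trans ?_
        refine (condExp_congr_ae hPD0).trans ?_
        rw [condExp_zero]
      rw [hsucc]
      refine ⟨hVi.add hPD, hVq.trans ?_⟩
      refine Filter.EventuallyEq.trans ?_ (condExp_add hVi hPD _).symm
      filter_upwards [hPD0'] with ω hω
      simp [hω]
  exact fun t w ht => (hmain t w ht).2
end

section
/- Let T ∈ ℕ, K ≥ 1, and let a_0, …, a_T and b_0, …, b_{T−1} be nonnegative real numbers with a_T = 0. Suppose that for every t ∈ {0, …, T−1} there exists w_t ∈ {0, …, T−t−1} such that a_t ≤ K · ( b_t + ( Σ_{s=t+1}^{t+w_t+1} √(a_s) )^2 ). Then there exists a constant c̄ depending only on K and T such that for every t ∈ {0, …, T−1}, a_t ≤ c̄ · Σ_{s=t}^{T−1} b_s. -/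
open Finset

/-- If `a s ≤ M` on a set of at most `N` indices, the squared sum of the square roots of the
`a s` over that set is at most `N ^ 2 * M`. -/
theorem sq_sum_sqrt_le {ι : Type*} {I : Finset ι} {a : ι → ℝ} {M : ℝ} {N : ℕ}
    (ha : ∀ s ∈ I, 0 ≤ a s) (haM : ∀ s ∈ I, a s ≤ M) (hM : 0 ≤ M) (hI : #I ≤ N) :
    (∑ s ∈ I, Real.sqrt (a s)) ^ 2 ≤ (N : ℝ) ^ 2 * M := by
  have hN : (#I : ℝ) ≤ N := by exact_mod_cast hI
  calc (∑ s ∈ I, Real.sqrt (a s)) ^ 2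
      ≤ #I * ∑ s ∈ I, Real.sqrt (a s) ^ 2 := sq_sum_le_card_mul_sum_sq
    _ = #I * ∑ s ∈ I, a s := by
        rw [Finset.sum_congr rfl fun s hs => Real.sq_sqrt (ha s hs)]
    _ ≤ #I * (#I * M) := by
        gcongr
        simpa using Finset.sum_le_card_nsmul I a M haM
    _ ≤ N * (N * M) := by gcongr
    _ = (N : ℝ) ^ 2 * M := by ring

/-- The error recursion with a constant depending on the remaining time `T - t ≤ n`. -/
theorem error_recursion_of_sub_le (T : ℕ) {K : ℝ} (hK : 0 ≤ K) (n : ℕ) :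
    ∃ c : ℝ, 0 ≤ c ∧ ∀ a b : ℕ → ℝ,
      (∀ s, 0 ≤ a s) → (∀ s, 0 ≤ b s) → a T = 0 →
      (∀ t, t < T → ∃ w, w ≤ T - t - 1 ∧
        a t ≤ K * (b t + (∑ s ∈ Finset.Icc (t + 1) (t + w + 1), Real.sqrt (a s)) ^ 2)) →
      ∀ t, t ≤ T → T - t ≤ n → a t ≤ c * ∑ s ∈ Finset.Ico t T, b s := by
  induction n with
  | zero =>
    refine ⟨0, le_rfl, fun a b _ _ haT _ t ht htn => ?_⟩
    obtain rfl : t = T := by lia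
    simp [haT]
  | succ n ih =>
    obtain ⟨c, hc, ih⟩ := ih
    refine ⟨K * (1 + (T : ℝ) ^ 2 * c), by positivity, fun a b ha hb haT hrec t ht htn => ?_⟩
    obtain rfl | htT := ht.eq_or_lt
    · simp [haT]
    obtain ⟨w, hw, hat⟩ := hrec t htT
    set S := ∑ s ∈ Finset.Ico t T, b s
    have hS : 0 ≤ S := Finset.sum_nonneg fun s _ => hb s
    have hbt : b t ≤ S :=
      Finset.single_le_sum (fun s _ => hb s) (Finset.mem_Ico.2 ⟨le_rfl, htT⟩)
    have haS : ∀ s ∈ Finset.Icc (t + 1) (t + w + 1), a s ≤ c * S := fun s hs => by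
      rw [Finset.mem_Icc] at hs
      refine (ih a b ha hb haT hrec s (by lia) (by lia)).trans ?_
      refine mul_le_mul_of_nonneg_left ?_ hc
      exact Finset.sum_le_sum_of_subset_of_nonneg
        (Finset.Ico_subset_Ico_left (by lia)) fun s _ _ => hb s
    have hsq := sq_sum_sqrt_le (N := T) (fun s _ => ha s) haS (by positivity)
      (by rw [Nat.card_Icc]; lia)
    calc a t ≤ K * (S + (T : ℝ) ^ 2 * (c * S)) := hat.trans (by gcongr)
      _ = K * (1 + (T : ℝ) ^ 2 * c) * S := by ring

/-- **Deterministic error-propagation recursion.** Let `T ∈ ℕ`, `K ≥ 1`, and let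
`a_0, …, a_T` and `b_0, …, b_{T−1}` be nonnegative reals with `a_T = 0` such that for every
`t < T` there is `w_t ∈ {0, …, T−t−1}` with
`a_t ≤ K · (b_t + (Σ_{s=t+1}^{t+w_t+1} √(a_s))²)`.
Then there is a constant `c̄` depending only on `K` and `T` with
`a_t ≤ c̄ · Σ_{s=t}^{T−1} b_s` for every `t < T`. -/
theorem error_recursion (T : ℕ) (K : ℝ) (hK : 1 ≤ K) :
    ∃ c : ℝ, ∀ a b : ℕ → ℝ,
      (∀ s, 0 ≤ a s) → (∀ s, 0 ≤ b s) → a T = 0 →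
      (∀ t, t < T → ∃ w, w ≤ T - t - 1 ∧
        a t ≤ K * (b t + (∑ s ∈ Finset.Icc (t + 1) (t + w + 1), Real.sqrt (a s)) ^ 2)) →
      ∀ t, t < T → a t ≤ c * ∑ s ∈ Finset.Icc t (T - 1), b s := by
  obtain ⟨c, -, h⟩ := error_recursion_of_sub_le T (zero_le_one.trans hK) T
  refine ⟨c, fun a b ha hb haT hrec t ht => ?_⟩
  have hIcc : Finset.Icc t (T - 1) = Finset.Ico t T := by
    ext s
    simp only [Finset.mem_Icc, Finset.mem_Ico]
    lia
  rw [hIcc]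
  exact h a b ha hb haT hrec t ht.le (Nat.sub_le T t)
end
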